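/- Let g, h ∈ F_r be translation equivalent, i.e., ‖φ(g)‖ = ‖φ(h)‖ for every automorphism φ of F_r. Let w be any element of the free group F_2 on two generators, and for a, b ∈ F_r let w(a,b) ∈ F_r denote the image of w under the homomorphism F_2 → F_r sending the first generator to a and the second generator to b. Then w(g,h) and w(h,g) are translation equivalent in F_r: for every automorphism φ of F_r, ‖φ(w(g,h))‖ = ‖φ(w(h,g))‖. -/

import Mathlib

/-- `FG r` is the free group `F_r` of rank `r`, with free generating set
`x_1, …, x_r` given by `FreeGroup.of 0, …, FreeGroup.of (r-1)`. -/
abbrev FG (r : ℕ) := FreeGroup (Fin r)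

/-- `|w|`, the length of the reduced word representing `w`. -/
def wordLength {r : ℕ} (w : FG r) : ℕ := w.toWord.length

/-- `w` is cyclically reduced: its reduced word is empty, or its first letter is not
the inverse of its last letter.  (A letter `(i, b)` has inverse `(i, !b)`.) -/
def CyclicallyReduced {r : ℕ} (w : FG r) : Prop :=
  ∀ a ∈ w.toWord.head?, ∀ b ∈ w.toWord.getLast?, a ≠ (b.1, !b.2)

/-- `p` is a primitive element of `F_r`: the image of `x_1` under some automorphism. -/
def Primitive {r : ℕ} (hr : 0 < r) (p : FG r) : Prop :=
  ∃ φ : FG r ≃* FG r, φ (FreeGroup.of ⟨0, hr⟩) = p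

/-- `v` is primitivity-blocking: the reduced word of `v` is not an infix of the reduced
word of any cyclically reduced primitive element of `F_r`. -/
def PrimitivityBlocking {r : ℕ} (hr : 0 < r) (v : FG r) : Prop :=
  ∀ p : FG r, Primitive hr p → CyclicallyReduced p → ¬ v.toWord <:+: p.toWord

/-- `v` is `w`-orbit-blocking: for every automorphism `φ` with `φ w` cyclically reduced,
the reduced word of `v` is not an infix of the reduced word of `φ w`. -/
def OrbitBlocking {r : ℕ} (w v : FG r) : Prop :=
  ∀ φ : FG r ≃* FG r, CyclicallyReduced (φ w) → ¬ v.toWord <:+: (φ w).toWord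

/-- `u` is positive: every letter of its reduced word is a generator (not an inverse). -/
def Positive {r : ℕ} (u : FG r) : Prop := ∀ l ∈ u.toWord, l.2 = true

/-- The cyclic length `‖u‖`: the minimum of `|g u g⁻¹|` over all `g`. -/
noncomputable def cyclicLength {r : ℕ} (u : FG r) : ℕ :=
  sInf (Set.range fun g : FG r => wordLength (g * u * g⁻¹))

/-- `gen r j` is the generator `x_{j+1}` of `F_r` (0-indexed: the `j`-th generator),
for `j < r`. -/
def gen (r : ℕ) (j : ℕ) : FG r :=
  if h : j < r then FreeGroup.of ⟨j, h⟩ else 1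

/-- `(b_1, …, b_r)` is a basis of `F_r`: some automorphism sends `x_i` to `b_i`. -/
def IsBasis {r : ℕ} (b : Fin r → FG r) : Prop :=
  ∃ φ : FG r ≃* FG r, ∀ i, φ (FreeGroup.of i) = b i

namespace FreeGroup

variable {α : Type*}

/-- The length of the longest common prefix of two lists. -/
def commonPrefixLength {β : Type*} [DecidableEq β] : List β → List β → ℕ
  | a :: A, b :: B => if a = b then commonPrefixLength A B + 1 else 0
  | _, _ => 0

theorem min_commonPrefixLength_le {β : Type*} [DecidableEq β] (A B C : List β) :
    min (commonPrefixLength A B) (commonPrefixLength B C) ≤ commonPrefixLength A C := by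
  induction A generalizing B C with
  | nil => cases B <;> simp [commonPrefixLength]
  | cons a A ih =>
    cases B with
    | nil => simp [commonPrefixLength]
    | cons b B =>
      cases C with
      | nil => simp [commonPrefixLength]
      | cons c C =>
        have := ih B C
        simp only [commonPrefixLength]
        split_ifs <;> first | omega | simp_all

theorem mk_cons (a : α × Bool) (L : List (α × Bool)) : mk (a :: L) = mk [a] * mk L := by
  rw [mul_mk]; rfl

/-- The evaluation of a letter at the pair `(g, h)`. -/
def evalLetter (g h : FreeGroup α) (p : Fin 2 × Bool) : FreeGroup α :=
  cond p.2 (![g, h] p.1) (![g, h] p.1)⁻¹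

/-- The evaluation of a word at the pair `(g, h)`. -/
def evalWord (g h : FreeGroup α) (V : List (Fin 2 × Bool)) : FreeGroup α :=
  (V.map (evalLetter g h)).prod

theorem evalLetter_swap (g h : FreeGroup α) (p : Fin 2 × Bool) :
    evalLetter h g p = evalLetter g h (p.1.rev, p.2) := by
  obtain ⟨i, b⟩ := p
  fin_cases i <;> simp [evalLetter]

theorem lift_eq_evalWord (g h : FreeGroup α) (w : FreeGroup (Fin 2)) :
    lift ![g, h] w = evalWord g h w.toWord := by
  conv_lhs => rw [← mk_toWord (x := w)]
  rw [lift_mk]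
  rfl

variable [DecidableEq α]

theorem norm_mk_of_isReduced {L : List (α × Bool)} (hL : IsReduced L) :
    norm (mk L) = L.length := by
  rw [norm, toWord_mk, hL.reduce_eq]

theorem norm_inv_mk_mul_mk (A B : List (α × Bool)) (hA : IsReduced A) (hB : IsReduced B) :
    norm ((mk A)⁻¹ * mk B) + 2 * commonPrefixLength A B = A.length + B.length := by
  induction A generalizing B with
  | nil => simp [commonPrefixLength, ← one_eq_mk, norm_mk_of_isReduced hB]
  | cons a A ih =>
    cases B with
    | nil => simp [commonPrefixLength, ← one_eq_mk, -inv_mk, norm_mk_of_isReduced hA]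
    | cons b B =>
      by_cases hab : a = b
      · subst hab
        have := ih B (hA.infix ⟨[a], [], by simp⟩) (hB.infix ⟨[a], [], by simp⟩)
        have e : (mk (a :: A))⁻¹ * mk (a :: B) = (mk A)⁻¹ * mk B := by
          rw [mk_cons a A, mk_cons a B]; group
        rw [e]
        simp only [commonPrefixLength, if_true, List.length_cons]
        omega
      · have hA' : IsReduced (invRev (a :: A)) := by
          rw [isReduced_iff_reduce_eq, reduce_invRev, hA.reduce_eq]
        have hred : IsReduced (invRev (a :: A) ++ b :: B) := by
          rw [IsReduced, List.isChain_append]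
          refine ⟨hA', hB, ?_⟩
          intro x hx y hy hxy
          simp [invRev] at hx hy
          subst hx hy
          obtain ⟨a₁, a₂⟩ := a
          obtain ⟨b₁, b₂⟩ := b
          simp only at hxy
          subst hxy
          cases a₂ <;> cases b₂ <;> simp_all
        rw [inv_mk, mul_mk, norm_mk_of_isReduced hred]
        simp [commonPrefixLength, hab]

/-- Twice the Gromov product of `x` and `y` based at `1` in the Cayley tree. -/
def gromov (x y : FreeGroup α) : ℤ := norm x + norm y - norm (x⁻¹ * y)

theorem gromov_eq (x y : FreeGroup α) :
    gromov x y = 2 * commonPrefixLength x.toWord y.toWord := by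
  have := norm_inv_mk_mul_mk x.toWord y.toWord isReduced_toWord isReduced_toWord
  rw [mk_toWord, mk_toWord] at this
  simp only [gromov, norm] at this ⊢
  omega

theorem gromov_nonneg (x y : FreeGroup α) : 0 ≤ gromov x y := by
  rw [gromov_eq]; positivity

theorem gromov_comm (x y : FreeGroup α) : gromov x y = gromov y x := by
  have : norm (x⁻¹ * y) = norm (y⁻¹ * x) := by rw [← norm_inv_eq]; simp
  simp only [gromov, this]; ring

theorem min_gromov_le (x y z : FreeGroup α) :
    min (gromov x y) (gromov y z) ≤ gromov x z := by
  have := min_commonPrefixLength_le x.toWord y.toWord z.toWord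
  simp only [gromov_eq]
  omega

theorem norm_mul_eq (x y : FreeGroup α) :
    (norm (x * y) : ℤ) = norm x + norm y - gromov x⁻¹ y := by
  simp [gromov]

theorem exists_common_first_letter {x y : FreeGroup α} (hxy : 0 < gromov x y) :
    ∃ s : FreeGroup α, norm s = 1 ∧ norm (s⁻¹ * x) + 1 = norm x ∧
      norm (s⁻¹ * y) + 1 = norm y := by
  have key : ∀ (z : FreeGroup α) (a : α × Bool) (A : List (α × Bool)), z.toWord = a :: A →
      norm ((mk [a])⁻¹ * z) + 1 = norm z := by
    intro z a A hz
    have hA : IsReduced A := by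
      have := isReduced_toWord (x := z)
      rw [hz] at this
      exact this.infix ⟨[a], [], by simp⟩
    have e : (mk [a])⁻¹ * z = mk A := by
      rw [← mk_toWord (x := z), hz, mk_cons a A]; group
    rw [e, norm_mk_of_isReduced hA, norm, hz, List.length_cons]
  rw [gromov_eq] at hxy
  rcases hx : x.toWord with _ | ⟨a, A⟩
  · simp [hx, commonPrefixLength] at hxy
  rcases hy : y.toWord with _ | ⟨b, B⟩
  · simp [hy, hx, commonPrefixLength] at hxy
  by_cases hab : a = b
  · subst hab
    exact ⟨mk [a], norm_mk_of_isReduced IsReduced.singleton, key x a A hx, key y a B hy⟩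
  · simp [hx, hy, commonPrefixLength, hab] at hxy

/-- The length of the cyclic reduction of the reduced word of `u`. -/
def cyclicNorm (u : FreeGroup α) : ℕ := (reduceCyclically u.toWord).length

theorem exists_norm_pow_eq (u : FreeGroup α) :
    ∃ c : ℕ, ∀ n : ℕ, norm (u ^ (n + 1)) = 2 * c + (n + 1) * cyclicNorm u := by
  refine ⟨(reduceCyclically.conjugator u.toWord).length, fun n => ?_⟩
  rw [norm, toWord_pow, reduceCyclically.reduce_flatten_replicate_succ isReduced_toWord]
  simp [cyclicNorm]
  ring

theorem norm_mul_self_eq (u : FreeGroup α) : norm (u * u) = norm u + cyclicNorm u := by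
  obtain ⟨c, hc⟩ := exists_norm_pow_eq u
  have h0 := hc 0
  have h1 := hc 1
  simp only [zero_add, pow_one, one_add_one_eq_two, pow_two] at h0 h1
  omega

theorem cyclicNorm_pos {u : FreeGroup α} (hu : u ≠ 1) : 0 < cyclicNorm u := by
  by_contra! h
  obtain ⟨c, hc⟩ := exists_norm_pow_eq u
  have h0 : cyclicNorm u = 0 := by omega
  have hnil : reduceCyclically u.toWord = [] := List.length_eq_zero_iff.mp h0
  have := reduceCyclically.conj_conjugator_reduceCyclically u.toWord
  rw [hnil] at this
  apply hu
  rw [← mk_toWord (x := u), ← this]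
  simp [← mul_mk, ← inv_mk]

theorem cyclicNorm_one : cyclicNorm (1 : FreeGroup α) = 0 := by
  simp [cyclicNorm]

theorem exists_norm_conj_le (u : FreeGroup α) :
    ∃ t : FreeGroup α, norm (t * u * t⁻¹) ≤ cyclicNorm u := by
  refine ⟨(mk (reduceCyclically.conjugator u.toWord))⁻¹, ?_⟩
  have e : (mk (reduceCyclically.conjugator u.toWord))⁻¹ * u *
      (mk (reduceCyclically.conjugator u.toWord))⁻¹⁻¹ = mk (reduceCyclically u.toWord) := by
    nth_rewrite 2 [← mk_toWord (x := u)]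
    nth_rewrite 2 [← reduceCyclically.conj_conjugator_reduceCyclically u.toWord]
    rw [← mul_mk, ← mul_mk, ← inv_mk]
    group
  rw [e]
  exact norm_mk_le

theorem norm_pow_le (u : FreeGroup α) (n : ℕ) : norm (u ^ n) ≤ n * norm u := by
  induction n with
  | zero => simp
  | succ n ih =>
    rw [pow_succ]
    have := norm_mul_le (u ^ n) u
    linarith

theorem cyclicNorm_le_of_norm_pow_le {u : FreeGroup α} {m K : ℕ}
    (h : ∀ n : ℕ, norm (u ^ n) ≤ n * m + K) : cyclicNorm u ≤ m := by
  by_contra! hlt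
  obtain ⟨c, hc⟩ := exists_norm_pow_eq u
  have h1 := h (K + 1)
  rw [hc K] at h1
  nlinarith

theorem cyclicNorm_le_norm_conj (u t : FreeGroup α) :
    cyclicNorm u ≤ norm (t * u * t⁻¹) := by
  refine cyclicNorm_le_of_norm_pow_le (K := 2 * norm t) fun n => ?_
  have e : u ^ n = t⁻¹ * (t * u * t⁻¹) ^ n * t := by
    rw [conj_pow]; group
  have h1 := norm_mul_le (t⁻¹ * (t * u * t⁻¹) ^ n) t
  have h2 := norm_mul_le t⁻¹ ((t * u * t⁻¹) ^ n)
  have h3 := norm_pow_le (t * u * t⁻¹) n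
  rw [norm_inv_eq] at h2
  rw [e]
  linarith

theorem cyclicNorm_conj (u t : FreeGroup α) : cyclicNorm (t * u * t⁻¹) = cyclicNorm u := by
  apply le_antisymm
  · obtain ⟨s, hs⟩ := exists_norm_conj_le u
    refine le_trans (cyclicNorm_le_norm_conj _ (s * t⁻¹)) (le_of_eq_of_le ?_ hs)
    congr 1
    group
  · obtain ⟨s, hs⟩ := exists_norm_conj_le (t * u * t⁻¹)
    refine le_trans (cyclicNorm_le_norm_conj _ (s * t)) (le_of_eq_of_le ?_ hs)
    congr 1
    group

theorem cyclicNorm_le_of_norm_pow_le_norm_pow {u v : FreeGroup α} {K : ℕ}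
    (h : ∀ n : ℕ, norm (u ^ n) ≤ norm (v ^ n) + K) : cyclicNorm u ≤ cyclicNorm v := by
  obtain ⟨c, hc⟩ := exists_norm_pow_eq v
  refine cyclicNorm_le_of_norm_pow_le (K := 2 * c + K) fun n => ?_
  cases n with
  | zero => simp
  | succ n => linarith [h (n + 1), hc n]

theorem gromov_inv_self (u : FreeGroup α) : gromov u⁻¹ u = norm u - cyclicNorm u := by
  have := norm_mul_self_eq u
  have h2 := norm_mul_eq u u
  omega

theorem gromov_self_inv (u : FreeGroup α) : gromov u u⁻¹ = norm u - cyclicNorm u := by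
  rw [gromov_comm, gromov_inv_self]

theorem gromov_inv_self_lt {u : FreeGroup α} (hu : u ≠ 1) : gromov u⁻¹ u < norm u := by
  have := cyclicNorm_pos hu
  rw [gromov_inv_self]; omega

/-- If the axes of `x` and `y` overlap at least along a common translation length,
then `x = y`. -/
theorem gromov_add_gromov_inv_lt {x y : FreeGroup α} (hxy : x ≠ y) (hn : norm x = norm y) :
    gromov x y + gromov x⁻¹ y⁻¹ < 2 * norm x := by
  by_contra! hle
  set e := x⁻¹ * y with he
  have he1 : e ≠ 1 := fun h => hxy (inv_mul_eq_one.mp h)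
  have h1 : gromov e x⁻¹ = norm e := by
    have : norm (e⁻¹ * x⁻¹) = norm y := by
      rw [← norm_inv_eq, he]; congr 1; group
    simp only [gromov, this, norm_inv_eq]; omega
  have h2 : gromov y⁻¹ e⁻¹ = norm e := by
    have : norm (y⁻¹⁻¹ * e⁻¹) = norm x := by
      rw [he]; congr 1; group
    simp only [gromov, this, norm_inv_eq]; omega
  have h3 : gromov x y = 2 * norm x - norm e := by
    simp only [gromov, he]; omega
  have h4 := min_gromov_le e x⁻¹ y⁻¹
  have h5 := min_gromov_le e y⁻¹ e⁻¹
  have h6 := gromov_inv_self_lt he1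
  rw [gromov_comm] at h6
  omega

/-- Two consecutive cancellations in a reduced word in `g` and `h` never exhaust a letter. -/
def SmallCancellation (g h : FreeGroup α) : Prop :=
  ∀ p y q : Fin 2 × Bool, (p.1 = y.1 → p.2 = y.2) → (y.1 = q.1 → y.2 = q.2) →
    gromov (evalLetter g h p)⁻¹ (evalLetter g h y) +
      gromov (evalLetter g h y)⁻¹ (evalLetter g h q) < 2 * norm (evalLetter g h y)

theorem SmallCancellation.symm {g h : FreeGroup α} (H : SmallCancellation g h) :
    SmallCancellation h g := by
  intro p y q hpy hyq
  simp only [evalLetter_swap g h]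
  exact H _ _ _ (by simpa using hpy) (by simpa using hyq)

theorem SmallCancellation.gromov_evalWord {g h : FreeGroup α} (H : SmallCancellation g h)
    (V : List (Fin 2 × Bool)) (p x : Fin 2 × Bool) (hV : IsReduced (p :: x :: V)) :
    gromov (evalLetter g h p)⁻¹ (evalWord g h (x :: V)) =
      gromov (evalLetter g h p)⁻¹ (evalLetter g h x) := by
  induction V generalizing p x with
  | nil => simp [evalWord]
  | cons y V ih =>
    rw [isReduced_cons_cons] at hV
    have hxy := (isReduced_cons_cons.mp hV.2).1
    have hQ := ih x y hV.2
    have e : evalWord g h (x :: y :: V) = evalLetter g h x * evalWord g h (y :: V) := by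
      simp [evalWord]
    have hlt := H p x y hV.1 hxy
    have h1 : gromov (evalLetter g h x) (evalWord g h (x :: y :: V)) =
        2 * norm (evalLetter g h x) - gromov (evalLetter g h x)⁻¹ (evalLetter g h y) := by
      have h2 := norm_mul_eq (evalLetter g h x) (evalWord g h (y :: V))
      rw [hQ] at h2
      rw [e, gromov, h2, inv_mul_cancel_left]
      ring
    have h3 := min_gromov_le (evalLetter g h p)⁻¹ (evalLetter g h x) (evalWord g h (x :: y :: V))
    have h4 := min_gromov_le (evalLetter g h p)⁻¹ (evalWord g h (x :: y :: V)) (evalLetter g h x)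
    rw [gromov_comm (evalWord g h (x :: y :: V)) (evalLetter g h x)] at h4
    omega

theorem SmallCancellation.norm_evalWord {g h : FreeGroup α} (H : SmallCancellation g h)
    (V : List (Fin 2 × Bool)) (p x : Fin 2 × Bool) (hV : IsReduced (p :: x :: V)) :
    (norm (evalWord g h (p :: x :: V)) : ℤ) = norm (evalWord g h (x :: V)) +
      (norm (evalLetter g h p) - gromov (evalLetter g h p)⁻¹ (evalLetter g h x)) := by
  have e : evalWord g h (p :: x :: V) = evalLetter g h p * evalWord g h (x :: V) := by
    simp [evalWord]
  rw [e, norm_mul_eq, H.gromov_evalWord V p x hV]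
  ring

/-- The potential whose coboundary is the change of the length cost under swapping
`g` and `h`. -/
def swapPotential (g h : FreeGroup α) (p : Fin 2 × Bool) : ℤ :=
  ![cond p.2 0 (gromov g⁻¹ h - gromov g h⁻¹),
    cond p.2 (norm h - norm g + gromov g⁻¹ h - gromov g h⁻¹) (norm h - norm g)] p.1

theorem cost_swap_sub_cost {g h : FreeGroup α} (hgh : cyclicNorm g = cyclicNorm h)
    (p x : Fin 2 × Bool) (hpx : p.1 = x.1 → p.2 = x.2) :
    ((norm (evalLetter h g p) : ℤ) - gromov (evalLetter h g p)⁻¹ (evalLetter h g x)) -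
      (norm (evalLetter g h p) - gromov (evalLetter g h p)⁻¹ (evalLetter g h x)) =
      swapPotential g h x - swapPotential g h p := by
  obtain ⟨i, b⟩ := p
  obtain ⟨j, c⟩ := x
  have h1 := gromov_inv_self g
  have h2 := gromov_inv_self h
  have h3 := gromov_self_inv g
  have h4 := gromov_self_inv h
  have c1 := gromov_comm g h
  have c2 := gromov_comm g⁻¹ h
  have c3 := gromov_comm g h⁻¹
  have c4 := gromov_comm g⁻¹ h⁻¹
  fin_cases i <;> fin_cases j <;> cases b <;> cases c <;>
    simp [evalLetter, swapPotential] at hpx ⊢ <;> omega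

theorem abs_norm_evalWord_swap_le {g h : FreeGroup α} (H : SmallCancellation g h)
    (hgh : cyclicNorm g = cyclicNorm h) {K : ℤ}
    (hK : ∀ x : Fin 2 × Bool, |(norm (evalLetter h g x) : ℤ) - norm (evalLetter g h x) +
      swapPotential g h x| ≤ K)
    (V : List (Fin 2 × Bool)) (x : Fin 2 × Bool) (hV : IsReduced (x :: V)) :
    |(norm (evalWord h g (x :: V)) : ℤ) - norm (evalWord g h (x :: V)) +
      swapPotential g h x| ≤ K := by
  induction V generalizing x with
  | nil => simpa [evalWord] using hK x
  | cons y V ih =>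
    have hxy := isReduced_cons_cons.mp hV
    refine le_of_eq_of_le (congrArg _ ?_) (ih y hxy.2)
    rw [H.norm_evalWord V x y hV, H.symm.norm_evalWord V x y hV]
    linarith [cost_swap_sub_cost hgh x y hxy.1]

theorem SmallCancellation.exists_bound {g h : FreeGroup α} (H : SmallCancellation g h)
    (hgh : cyclicNorm g = cyclicNorm h) :
    ∃ K : ℤ, ∀ w : FreeGroup (Fin 2),
      |(norm (lift ![h, g] w) : ℤ) - norm (lift ![g, h] w)| ≤ K := by
  obtain ⟨K, hK⟩ := Finite.exists_le fun x : Fin 2 × Bool =>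
    |(norm (evalLetter h g x) : ℤ) - norm (evalLetter g h x) + swapPotential g h x|
  obtain ⟨M, hM⟩ := Finite.exists_le fun x : Fin 2 × Bool => |swapPotential g h x|
  refine ⟨K + M, fun w => ?_⟩
  rw [lift_eq_evalWord, lift_eq_evalWord]
  have hred := isReduced_toWord (x := w)
  generalize w.toWord = L at hred
  rcases L with _ | ⟨x, V⟩
  · have h1 := (abs_nonneg _).trans (hK (0, true))
    have h2 := (abs_nonneg _).trans (hM (0, true))
    simp only [evalWord, List.map_nil, List.prod_nil, sub_self, abs_zero]
    linarith
  · have h1 := abs_le.mp (abs_norm_evalWord_swap_le H hgh hK V x hred)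
    have h2 := abs_le.mp (hM x)
    exact abs_le.mpr ⟨by linarith, by linarith⟩

theorem smallCancellation_of_gromov_self_inv_eq_zero {g h : FreeGroup α} (hg : g ≠ 1)
    (hne : g ≠ h) (hne' : g ≠ h⁻¹) (hn : norm g = norm h) (hgg : gromov g g⁻¹ = 0)
    (hhh : gromov h h⁻¹ = 0) : SmallCancellation g h := by
  have hpos : 0 < norm g := Nat.pos_of_ne_zero (norm_eq_zero.not.mpr hg)
  have a1 := gromov_add_gromov_inv_lt hne hn
  have a2 := gromov_add_gromov_inv_lt hne' (by rwa [norm_inv_eq])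
  rw [inv_inv] at a2
  have c1 := gromov_comm g h
  have c2 := gromov_comm g⁻¹ h
  have c3 := gromov_comm g h⁻¹
  have c4 := gromov_comm g⁻¹ h⁻¹
  have c5 := gromov_comm g g⁻¹
  have c6 := gromov_comm h h⁻¹
  have n1 := gromov_nonneg g h
  have n2 := gromov_nonneg g⁻¹ h
  have n3 := gromov_nonneg g h⁻¹
  have n4 := gromov_nonneg g⁻¹ h⁻¹
  have m1 := min_gromov_le h g h⁻¹
  have m2 := min_gromov_le h g⁻¹ h⁻¹
  have m3 := min_gromov_le g h g⁻¹
  have m4 := min_gromov_le g h⁻¹ g⁻¹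
  rintro ⟨i, b⟩ ⟨j, c⟩ ⟨k, d⟩ hpy hyq
  fin_cases i <;> fin_cases j <;> fin_cases k <;> cases b <;> cases c <;> cases d <;>
    simp [evalLetter, norm_inv_eq] at hpy hyq ⊢ <;> omega

theorem smallCancellation_of_gromov_eq_zero {g h : FreeGroup α} (hg : g ≠ 1) (hh : h ≠ 1)
    (hgg : gromov g g⁻¹ = 0) (h1 : gromov g h = 0) (h2 : gromov g⁻¹ h = 0)
    (h3 : gromov g h⁻¹ = 0) (h4 : gromov g⁻¹ h⁻¹ = 0) : SmallCancellation g h := by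
  have hpos : 0 < norm g := Nat.pos_of_ne_zero (norm_eq_zero.not.mpr hg)
  have hlt := gromov_inv_self_lt hh
  have hnn := gromov_nonneg h⁻¹ h
  have c1 := gromov_comm g h
  have c2 := gromov_comm g⁻¹ h
  have c3 := gromov_comm g h⁻¹
  have c4 := gromov_comm g⁻¹ h⁻¹
  have c5 := gromov_comm g g⁻¹
  have c6 := gromov_comm h h⁻¹
  rintro ⟨i, b⟩ ⟨j, c⟩ ⟨k, d⟩ hpy hyq
  fin_cases i <;> fin_cases j <;> fin_cases k <;> cases b <;> cases c <;> cases d <;>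
    simp [evalLetter, norm_inv_eq] at hpy hyq ⊢ <;> omega

theorem norm_conj_lt {h s : FreeGroup α} (hs : norm s = 1)
    (h1 : norm (s⁻¹ * h) + 1 = norm h) (h2 : norm (s⁻¹ * h⁻¹) + 1 = norm h) :
    norm (s⁻¹ * h * s) < norm h := by
  have e1 : norm (h⁻¹ * s) = norm (s⁻¹ * h) := by rw [← norm_inv_eq]; simp
  have a1 : gromov (h⁻¹ * s) h⁻¹ = 2 * norm h - 2 := by
    have : norm ((h⁻¹ * s)⁻¹ * h⁻¹) = 1 := by rw [← hs, ← norm_inv_eq (x := s)]; simp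
    simp only [gromov, this, norm_inv_eq, e1]; omega
  have a2 : gromov h⁻¹ s = 2 := by
    have : norm (h⁻¹⁻¹ * s) = norm (s⁻¹ * h⁻¹) := by rw [← norm_inv_eq]; simp
    simp only [gromov, this, norm_inv_eq, hs]; omega
  have a3 := min_gromov_le (h⁻¹ * s) h⁻¹ s
  have a4 : gromov (h⁻¹ * s) s = norm h - norm (s⁻¹ * h * s) := by
    have : norm ((h⁻¹ * s)⁻¹ * s) = norm (s⁻¹ * h * s) := by simp
    simp only [gromov, this, hs, e1]; omega
  have hle : 2 ≤ norm h := by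
    by_contra! hlt
    have b1 : norm (s⁻¹ * h) = 0 := by omega
    have b2 : norm (s⁻¹ * h⁻¹) = 0 := by omega
    rw [norm_eq_zero, inv_mul_eq_one] at b1 b2
    have hs1 : s ≠ 1 := by rintro rfl; simp at hs
    have := norm_mul_self_eq s
    have hss : s * s = 1 := by nth_rewrite 1 [b1]; rw [b2]; simp
    rw [hss, norm_one] at this
    omega
  omega

theorem gromov_eq_zero_of_minimal {g h : FreeGroup α} (hhh : gromov h h⁻¹ ≠ 0)
    (hmin : ∀ t : FreeGroup α, norm (t * g * t⁻¹) ≤ norm g → norm h ≤ norm (t * h * t⁻¹)) :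
    gromov g h = 0 := by
  by_contra hne
  have n1 := gromov_nonneg g h
  have n2 := gromov_nonneg h h⁻¹
  obtain ⟨s, hs, hsx, hsy⟩ := exists_common_first_letter (lt_of_le_of_ne n2 hhh.symm)
  obtain ⟨s', hs', hsx', hsy'⟩ := exists_common_first_letter (lt_of_le_of_ne n1 (Ne.symm hne))
  have hss : s = s' := by
    by_contra hd
    have k : ∀ t : FreeGroup α, norm t = 1 → norm (t⁻¹ * h) + 1 = norm h → gromov t h = 2 := by
      intro t ht hth
      simp only [gromov, ht]; omega
    have k1 := k s hs hsx
    have k2 := k s' hs' hsy'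
    rw [gromov_comm] at k2
    have k3 := min_gromov_le s h s'
    have k4 : norm (s⁻¹ * s') = 0 := by
      rw [k1, k2, min_self] at k3
      simp only [gromov, hs, hs'] at k3
      omega
    exact hd (inv_mul_eq_one.mp (norm_eq_zero.mp k4))
  subst hss
  rw [norm_inv_eq] at hsy
  have h1 := norm_conj_lt hs hsx hsy
  have h2 := hmin s⁻¹ (by
    have := norm_mul_le (s⁻¹ * g) s
    rw [inv_inv]
    omega)
  rw [inv_inv] at h2
  omega

theorem exists_bound_of_minimal {g h : FreeGroup α} (hgh : cyclicNorm g = cyclicNorm h)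
    (hg : norm g = cyclicNorm g)
    (hmin : ∀ t : FreeGroup α, norm (t * g * t⁻¹) ≤ norm g → norm h ≤ norm (t * h * t⁻¹)) :
    ∃ K : ℤ, ∀ w : FreeGroup (Fin 2),
      |(norm (lift ![h, g] w) : ℤ) - norm (lift ![g, h] w)| ≤ K := by
  rcases eq_or_ne g h with rfl | hne
  · exact ⟨0, by simp⟩
  rcases eq_or_ne g h⁻¹ with rfl | hne'
  · refine ⟨0, fun w => ?_⟩
    let χ : FreeGroup (Fin 2) →* Multiplicative ℤ :=
      lift ![Multiplicative.ofAdd 1, Multiplicative.ofAdd (-1)]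
    have e1 : lift ![h, h⁻¹] = (zpowersHom _ h).comp χ := by
      ext i; fin_cases i <;> simp [χ]
    have e2 : lift ![h⁻¹, h] = (zpowersHom _ h⁻¹).comp χ := by
      ext i; fin_cases i <;> simp [χ]
    have e3 : lift ![h⁻¹, h] w = (lift ![h, h⁻¹] w)⁻¹ := by
      simp [e1, e2]
    simp [e3]
  have hg1 : g ≠ 1 := by
    rintro rfl
    rw [cyclicNorm_one] at hgh
    by_contra
    have := cyclicNorm_pos hne.symm
    omega
  have hh1 : h ≠ 1 := by
    rintro rfl
    rw [cyclicNorm_one] at hgh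
    have := cyclicNorm_pos hg1
    omega
  have hgg : gromov g g⁻¹ = 0 := by rw [gromov_self_inv, hg, sub_self]
  refine SmallCancellation.exists_bound ?_ hgh
  by_cases hhh : gromov h h⁻¹ = 0
  · have := gromov_self_inv h
    exact smallCancellation_of_gromov_self_inv_eq_zero hg1 hne hne' (by omega) hgg hhh
  · have hhh' : gromov h⁻¹ h⁻¹⁻¹ ≠ 0 := by rwa [inv_inv, gromov_comm]
    have conj_inv' : ∀ t u : FreeGroup α, norm (t * u⁻¹ * t⁻¹) = norm (t * u * t⁻¹) := by
      intro t u
      rw [← norm_inv_eq]; congr 1; group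
    refine smallCancellation_of_gromov_eq_zero hg1 hh1 hgg
      (gromov_eq_zero_of_minimal hhh hmin) (gromov_eq_zero_of_minimal hhh ?_)
      (gromov_eq_zero_of_minimal hhh' ?_) (gromov_eq_zero_of_minimal hhh' ?_) <;>
    simpa only [conj_inv', norm_inv_eq] using hmin

theorem exists_minimal_conj (g h : FreeGroup α) :
    ∃ s : FreeGroup α, norm (s * g * s⁻¹) = cyclicNorm g ∧
      ∀ t : FreeGroup α, norm (t * g * t⁻¹) ≤ cyclicNorm g →
        norm (s * h * s⁻¹) ≤ norm (t * h * t⁻¹) := by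
  obtain ⟨s, hs, hmin⟩ := (measure fun t : FreeGroup α => norm (t * h * t⁻¹)).wf.has_min
    {t | norm (t * g * t⁻¹) ≤ cyclicNorm g} (exists_norm_conj_le g)
  exact ⟨s, le_antisymm hs (cyclicNorm_le_norm_conj g s),
    fun t ht => not_lt.mp (hmin t ht)⟩

/-- Elements with equal cyclic lengths are interchangeable in any two-variable word, as far
as the cyclic length of the value is concerned. -/
theorem cyclicNorm_lift_swap {g h : FreeGroup α} (hgh : cyclicNorm g = cyclicNorm h)
    (w : FreeGroup (Fin 2)) :
    cyclicNorm (lift ![g, h] w) = cyclicNorm (lift ![h, g] w) := by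
  obtain ⟨s, hs, hmin⟩ := exists_minimal_conj g h
  have hconj : ∀ a b : FreeGroup α,
      lift ![s * a * s⁻¹, s * b * s⁻¹] w = s * lift ![a, b] w * s⁻¹ := by
    intro a b
    have : lift ![s * a * s⁻¹, s * b * s⁻¹] =
        (MulAut.conj s).toMonoidHom.comp (lift ![a, b]) := by
      ext i; fin_cases i <;> simp
    simp [this]
  obtain ⟨K, hK⟩ := exists_bound_of_minimal (g := s * g * s⁻¹) (h := s * h * s⁻¹)
    (by rw [cyclicNorm_conj, cyclicNorm_conj, hgh]) (by rw [cyclicNorm_conj, hs])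
    (by
      intro t ht
      have e : ∀ a : FreeGroup α, t * (s * a * s⁻¹) * t⁻¹ = (t * s) * a * (t * s)⁻¹ := by
        intro a; group
      rw [e, hs] at ht
      rw [e]
      exact hmin _ ht)
  rw [← cyclicNorm_conj (lift ![g, h] w) s, ← cyclicNorm_conj (lift ![h, g] w) s,
    ← hconj, ← hconj]
  apply le_antisymm <;> refine cyclicNorm_le_of_norm_pow_le_norm_pow (K := K.toNat) fun n => ?_
  all_goals
    have := abs_le.mp (hK (w ^ n))
    simp only [map_pow] at this
    omega

end FreeGroup

theorem cyclicLength_eq_cyclicNorm {r : ℕ} (u : FG r) :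
    cyclicLength u = FreeGroup.cyclicNorm u := by
  apply le_antisymm
  · obtain ⟨t, ht⟩ := FreeGroup.exists_norm_conj_le u
    exact (Nat.sInf_le (Set.mem_range_self t)).trans ht
  · obtain ⟨t, ht⟩ := Nat.sInf_mem
      (Set.range_nonempty fun g : FG r => wordLength (g * u * g⁻¹))
    rw [cyclicLength, ← ht]
    exact FreeGroup.cyclicNorm_le_norm_conj u t

/-- If `g` and `h` are translation equivalent in `F_r`, then for any
word `w` in the free group on two generators, `w(g,h)` and `w(h,g)` are translation
equivalent in `F_r`. -/
theorem translation_equivalent_w_gh_hg {r : ℕ} (g h : FG r)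
    (hte : ∀ φ : FG r ≃* FG r, cyclicLength (φ g) = cyclicLength (φ h))
    (w : FreeGroup (Fin 2)) :
    ∀ φ : FG r ≃* FG r,
      cyclicLength (φ ((FreeGroup.lift ![g, h]) w)) =
        cyclicLength (φ ((FreeGroup.lift ![h, g]) w)) := by
  intro φ
  have hmap : ∀ a b : FG r, φ (FreeGroup.lift ![a, b] w) = FreeGroup.lift ![φ a, φ b] w := by
    intro a b
    have : φ.toMonoidHom.comp (FreeGroup.lift ![a, b]) = FreeGroup.lift ![φ a, φ b] := by
      ext i; fin_cases i <;> simp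
    exact DFunLike.congr_fun this w
  have hφ := hte φ
  rw [cyclicLength_eq_cyclicNorm, cyclicLength_eq_cyclicNorm] at hφ
  rw [hmap, hmap, cyclicLength_eq_cyclicNorm, cyclicLength_eq_cyclicNorm]
  exact FreeGroup.cyclicNorm_lift_swap hφ w
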